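/- t is reachable from s by a directed path in G if and only if there is a set D of at most k vertices of G″ such that the induced subgraph G″ ∖ D satisfies property P′. -/

import Mathlib

/-- A directed graph on `Fin n × Fin k` (layer `i+1`, 1-based, is `Fin n × {i}`) is a
*matched layered graph* if every edge goes from a layer to the next one, every vertex
outside the last layer has exactly one out-neighbor, and every vertex outside the
first layer has exactly one in-neighbor. -/
def MatchedLayered {n k : ℕ} (E : Fin n × Fin k → Fin n × Fin k → Prop) : Prop :=
  (∀ v w, E v w → (w.2 : ℕ) = (v.2 : ℕ) + 1) ∧
    (∀ v, (v.2 : ℕ) + 1 < k → ∃! w, E v w) ∧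
    (∀ w, 0 < (w.2 : ℕ) → ∃! v, E v w)

/-- The vertex set of the graph `G″`: the original vertices, the vertices `v⁺`
(for ends `v = (a, t.2)` of paths with `v ≠ t`), the vertices `v⁰` and `v⁻`
(for beginnings `v = (a, s.2)` of paths with `v ≠ s`), and one vertex `c*`. -/
def Vert (n k : ℕ) (s t : Fin n × Fin k) : Type :=
  (Fin n × Fin k) ⊕
    ({a : Fin n // a ≠ t.1} ⊕ ({a : Fin n // a ≠ s.1} ⊕ ({a : Fin n // a ≠ s.1} ⊕ Unit)))

/-- The (1-based) layer of a vertex of `G″`, in `{-1, 0, 1, …, k+1}`; the vertex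
`c*` lies in no layer. -/
def layer {n k : ℕ} {s t : Fin n × Fin k} : Vert n k s t → Option ℤ
  | Sum.inl (_, i) => some ((i : ℕ) + 1)
  | Sum.inr (Sum.inl _) => some ((k : ℤ) + 1)
  | Sum.inr (Sum.inr (Sum.inl _)) => some 0
  | Sum.inr (Sum.inr (Sum.inr (Sum.inl _))) => some (-1)
  | Sum.inr (Sum.inr (Sum.inr (Sum.inr _))) => none

/-- Generating relation for the edges of `G″`: the underlying undirected edges of `G`;
the edge `{v, v⁺}` for each path end `v ≠ t`; the triangle `{v, v⁰}, {v⁰, v⁻}, {v⁻, v}`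
for each path beginning `v ≠ s`; and, for every vertex `w` lying in a layer `i`, the
edge `{c*, w}` if `i ≡ 0 (mod 3)`, a self-loop at `w` if `i ≡ 1 (mod 3)`, and both if
`i ≡ 2 (mod 3)`. -/
inductive GRel {n k : ℕ} (E : Fin n × Fin k → Fin n × Fin k → Prop) (s t : Fin n × Fin k) :
    Vert n k s t → Vert n k s t → Prop
  | base {v w} : E v w → GRel E s t (Sum.inl v) (Sum.inl w)
  | plus (a : {a : Fin n // a ≠ t.1}) :
      GRel E s t (Sum.inl (a.1, t.2)) (Sum.inr (Sum.inl a))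
  | zero (a : {a : Fin n // a ≠ s.1}) :
      GRel E s t (Sum.inl (a.1, s.2)) (Sum.inr (Sum.inr (Sum.inl a)))
  | zeroMinus (a : {a : Fin n // a ≠ s.1}) :
      GRel E s t (Sum.inr (Sum.inr (Sum.inl a))) (Sum.inr (Sum.inr (Sum.inr (Sum.inl a))))
  | minusBase (a : {a : Fin n // a ≠ s.1}) :
      GRel E s t (Sum.inr (Sum.inr (Sum.inr (Sum.inl a)))) (Sum.inl (a.1, s.2))
  | cStar {w : Vert n k s t} {i : ℤ} : layer w = some i → (i % 3 = 0 ∨ i % 3 = 2) →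
      GRel E s t (Sum.inr (Sum.inr (Sum.inr (Sum.inr ())))) w
  | loop {w : Vert n k s t} {i : ℤ} : layer w = some i → (i % 3 = 1 ∨ i % 3 = 2) →
      GRel E s t w w

/-- The symmetric adjacency relation of `G″` (an undirected graph with self-loops
allowed). -/
def Adj'' {n k : ℕ} (E : Fin n × Fin k → Fin n × Fin k → Prop) (s t : Fin n × Fin k)
    (x y : Vert n k s t) : Prop :=
  GRel E s t x y ∨ GRel E s t y x

/-- Property `P′` of an undirected graph with self-loops allowed, given by a symmetric
adjacency relation `A`. -/
def PropP' {X : Type*} (A : X → X → Prop) : Prop :=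
  ∃ c : X, ∀ x : X, x ≠ c → ∃ y : X,
    y ≠ c ∧ (A x c ∨ A x x) ∧ A x y ∧
      (A x c ∧ A x x → A y y ∧ ¬ A y c) ∧
      (A x x ∧ ¬ A x c → A y c ∧ ¬ A y y) ∧
      (A x c ∧ ¬ A x x → A y c ∧ A y y)


section helpers
variable {n k : ℕ} {E : Fin n × Fin k → Fin n × Fin k → Prop} {s t : Fin n × Fin k}

inductive Down (E : Fin n × Fin k → Fin n × Fin k → Prop) (s t : Fin n × Fin k) :
    Vert n k s t → Vert n k s t → Prop
  | base {v w} : E v w → Down E s t (Sum.inl w) (Sum.inl v)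
  | plus (a : {a : Fin n // a ≠ t.1}) :
      Down E s t (Sum.inr (Sum.inl a)) (Sum.inl (a.1, t.2))
  | zero (a : {a : Fin n // a ≠ s.1}) :
      Down E s t (Sum.inl (a.1, s.2)) (Sum.inr (Sum.inr (Sum.inl a)))
  | zeroMinus (a : {a : Fin n // a ≠ s.1}) :
      Down E s t (Sum.inr (Sum.inr (Sum.inl a))) (Sum.inr (Sum.inr (Sum.inr (Sum.inl a))))
  | minusBase (a : {a : Fin n // a ≠ s.1}) :
      Down E s t (Sum.inr (Sum.inr (Sum.inr (Sum.inl a)))) (Sum.inl (a.1, s.2))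

def cst : Vert n k s t := Sum.inr (Sum.inr (Sum.inr (Sum.inr ())))

def gr (x : Vert n k s t) : ℤ :=
  match layer x with
  | some i => i % 3
  | none => 3

lemma layer_cases (x : Vert n k s t) :
    (x = cst ∧ layer x = none) ∨ (x ≠ cst ∧ ∃ i, layer x = some i) := by
  rcases x with ⟨a, i⟩ | a | a | a | a
  all_goals first
    | (left; exact ⟨rfl, rfl⟩)
    | (right; refine ⟨?_, _, rfl⟩; intro h; cases h)

lemma gr_cases (x : Vert n k s t) :
    (x = cst ∧ gr x = 3) ∨ (x ≠ cst ∧ (gr x = 0 ∨ gr x = 1 ∨ gr x = 2)) := by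
  unfold gr
  rcases layer_cases x with ⟨h, h'⟩ | ⟨h, i, h'⟩
  · left; simp [h, h'] ; rw [← h, h']
  · right; refine ⟨h, ?_⟩
    rw [h']; simp only; omega

lemma down_gr (hE : MatchedLayered E) (hs : (s.2 : ℕ) = 0) (ht : (t.2 : ℕ) + 1 = k)
    {x y : Vert n k s t} (h : Down E s t x y) :
    (gr x = 0 ∧ gr y = 2) ∨ (gr x = 1 ∧ gr y = 0) ∨ (gr x = 2 ∧ gr y = 1) := by
  cases h with
  | base h => have := hE.1 _ _ h; simp only [gr, layer]; omega
  | _ => simp only [gr, layer]; omega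

lemma down_fun (hE : MatchedLayered E) (hs : (s.2 : ℕ) = 0)
    {x y z : Vert n k s t} (h : Down E s t x y) (h' : Down E s t x z) : y = z := by
  cases h with
  | base h =>
    have h1 := hE.1 _ _ h
    cases h' with
    | base h'' => rw [(hE.2.2 _ (by omega)).unique h h'']
    | zero a => simp at h1; omega
  | zero a =>
    generalize hq : (Sum.inl (a.1, s.2) : Vert n k s t) = q at h'
    cases h' with
    | base h'' =>
      have h1 := hE.1 _ _ h''
      have h2 := congrArg Prod.snd (Sum.inl.inj hq)
      simp only at h2
      rw [← h2] at h1; omega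
    | zero b =>
      have h2 := congrArg Prod.fst (Sum.inl.inj hq)
      have : a = b := Subtype.ext h2
      rw [this]
    | _ => cases hq
  | _ => cases h'; rfl

lemma adj_iff (hE : MatchedLayered E) (hs : (s.2 : ℕ) = 0) (ht : (t.2 : ℕ) + 1 = k)
    (x y : Vert n k s t) :
    Adj'' E s t x y ↔ Down E s t x y ∨ Down E s t y x ∨ (x = y ∧ (gr x = 1 ∨ gr x = 2)) ∨
      (gr x = 3 ∧ (gr y = 0 ∨ gr y = 2)) ∨ (gr y = 3 ∧ (gr x = 0 ∨ gr x = 2)) := by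
  have key : ∀ x y : Vert n k s t, GRel E s t x y →
      Down E s t x y ∨ Down E s t y x ∨ (x = y ∧ (gr x = 1 ∨ gr x = 2)) ∨
      (gr x = 3 ∧ (gr y = 0 ∨ gr y = 2)) := by
    intro x y h
    cases h with
    | base h => exact Or.inr (Or.inl (.base h))
    | plus a => exact Or.inr (Or.inl (.plus a))
    | zero a => exact Or.inl (.zero a)
    | zeroMinus a => exact Or.inl (.zeroMinus a)
    | minusBase a => exact Or.inl (.minusBase a)
    | cStar h h' =>
      right; right; right
      refine ⟨rfl, ?_⟩
      unfold gr; rw [h]; exact h'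
    | loop h h' =>
      right; right; left
      refine ⟨rfl, ?_⟩
      unfold gr; rw [h]; exact h'
  have kd : ∀ x y : Vert n k s t, Down E s t x y → Adj'' E s t x y := by
    intro x y h
    cases h with
    | base h => exact Or.inr (.base h)
    | plus a => exact Or.inr (.plus a)
    | zero a => exact Or.inl (.zero a)
    | zeroMinus a => exact Or.inl (.zeroMinus a)
    | minusBase a => exact Or.inl (.minusBase a)
  have kc : ∀ x y : Vert n k s t, gr x = 3 → (gr y = 0 ∨ gr y = 2) → GRel E s t x y := by
    intro x y hx hy
    rcases gr_cases x with ⟨rfl, _⟩ | h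
    · rcases layer_cases y with ⟨rfl, _⟩ | ⟨h, i, h'⟩
      · exact absurd hy (by simp [gr, layer, cst])
      · unfold gr at hy; rw [h'] at hy; exact .cStar h' hy
    · omega
  constructor
  · rintro (h | h)
    · have := key _ _ h; tauto
    · have := key _ _ h
      rcases this with h | h | ⟨rfl, h⟩ | h <;> tauto
  · rintro (h | h | ⟨rfl, h⟩ | h | h)
    · exact kd _ _ h
    · exact (kd _ _ h).symm
    · left
      rcases layer_cases x with ⟨rfl, _⟩ | ⟨h1, i, h'⟩
      · exact absurd h (by simp [gr, layer, cst])
      · unfold gr at h; rw [h'] at h; exact .loop h' h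
    · exact Or.inl (kc _ _ h.1 h.2)
    · exact Or.inr (kc _ _ h.1 h.2)

/-- Local condition of `P′`, on the ambient vertex type. -/
def Good {X : Type*} (A : X → X → Prop) (c x y : X) : Prop :=
  y ≠ c ∧ (A x c ∨ A x x) ∧ A x y ∧
      (A x c ∧ A x x → A y y ∧ ¬ A y c) ∧
      (A x x ∧ ¬ A x c → A y c ∧ ¬ A y y) ∧
      (A x c ∧ ¬ A x x → A y c ∧ A y y)

lemma prop_iff {X : Type*} (A : X → X → Prop) (D : Set X) :
    PropP' (fun x y : ↥(Dᶜ) => A x.1 y.1) ↔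
      ∃ c, c ∉ D ∧ ∀ x, x ∉ D → x ≠ c → ∃ y, y ∉ D ∧ Good A c x y := by
  constructor
  · rintro ⟨c, h⟩
    refine ⟨c.1, c.2, fun x hx hxc => ?_⟩
    obtain ⟨y, hy, h'⟩ := h ⟨x, hx⟩ (fun h => hxc (by rw [← h]))
    exact ⟨y.1, y.2, fun h => hy (Subtype.ext h), h'⟩
  · rintro ⟨c, hc, h⟩
    refine ⟨⟨c, hc⟩, fun x hxc => ?_⟩
    obtain ⟨y, hyD, hy, h'⟩ := h x.1 x.2 (fun h => hxc (Subtype.ext h))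
    exact ⟨⟨y, hyD⟩, fun h => hy (congrArg Subtype.val h), h'⟩

lemma adj_self_iff (hE : MatchedLayered E) (hs : (s.2 : ℕ) = 0) (ht : (t.2 : ℕ) + 1 = k)
    (x : Vert n k s t) : Adj'' E s t x x ↔ gr x = 1 ∨ gr x = 2 := by
  rw [adj_iff hE hs ht]
  have d3 := @down_gr n k E s t hE hs ht x x
  constructor
  · rintro (h | h | h | h | h)
    · have := d3 h; omega
    · have := d3 h; omega
    · exact h.2
    · omega
    · omega
  · intro h; exact Or.inr (Or.inr (Or.inl ⟨rfl, h⟩))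

lemma adj_star_iff (hE : MatchedLayered E) (hs : (s.2 : ℕ) = 0) (ht : (t.2 : ℕ) + 1 = k)
    (x : Vert n k s t) : Adj'' E s t x cst ↔ gr x = 0 ∨ gr x = 2 := by
  rw [adj_iff hE hs ht]
  have hg : gr (cst : Vert n k s t) = 3 := rfl
  have d3 := @down_gr n k E s t hE hs ht x cst
  have d4 := @down_gr n k E s t hE hs ht cst x
  constructor
  · rintro (h | h | ⟨rfl, h⟩ | h | h)
    · have := d3 h; omega
    · have := d4 h; omega
    · omega
    · omega
    · exact h.2
  · intro h; exact Or.inr (Or.inr (Or.inr (Or.inr ⟨hg, h⟩)))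

lemma good_star (hE : MatchedLayered E) (hs : (s.2 : ℕ) = 0) (ht : (t.2 : ℕ) + 1 = k)
    {x y : Vert n k s t} (hx : x ≠ cst) :
    Good (Adj'' E s t) cst x y ↔ Down E s t x y := by
  have hg : gr (cst : Vert n k s t) = 3 := rfl
  have hxc := gr_cases x
  have hyc := gr_cases y
  have d1 := @down_gr n k E s t hE hs ht x y
  have d2 := @down_gr n k E s t hE hs ht y x
  simp only [Good, adj_self_iff hE hs ht, adj_star_iff hE hs ht]
  rw [adj_iff hE hs ht]
  constructor
  · rintro ⟨h1, h2, (h | h | ⟨rfl, h⟩ | h | h), h3, h4, h5⟩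
    · exact h
    · have := d2 h; omega
    · omega
    · omega
    · rcases hyc with hyc | hyc
      · exact absurd hyc.1 h1
      · omega
  · intro h
    have h' := d1 h
    refine ⟨?_, by omega, Or.inl h, by omega, by omega, by omega⟩
    rintro rfl
    omega

lemma only_star (hE : MatchedLayered E) (hs : (s.2 : ℕ) = 0) (ht : (t.2 : ℕ) + 1 = k)
    (D : Set (Vert n k s t)) (c x0 : Vert n k s t) (hx0 : x0 ∉ D) (hx0c : x0 ≠ c)
    (h : ∀ x, x ∉ D → x ≠ c → ∃ y, y ∉ D ∧ Good (Adj'' E s t) c x y) : c = cst := by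
  by_contra hc
  set A := Adj'' E s t with hA
  have hAi := adj_iff (E := E) hE hs ht
  have d := fun x y => @down_gr n k E s t hE hs ht x y
  have f := fun x y z => @down_fun n k E s t hE hs x y z
  have hg : gr (cst : Vert n k s t) = 3 := rfl
  have hgc := gr_cases c
  -- the chain
  have chain : ∀ z, z ∉ D → z ≠ c → A z c → ¬ A z z →
      ∃ a b w, a ≠ c ∧ b ≠ c ∧ w ≠ c ∧ w ∉ D ∧ A z a ∧ A a c ∧ A a a ∧ A a b ∧ A b b ∧ ¬ A b c ∧
        A b w ∧ A w c ∧ ¬ A w w := by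
    intro z hz hzc h1 h2
    obtain ⟨a, haD, hac, ha1, ha2, ha3, ha4, ha5⟩ := h z hz hzc
    have := ha5 ⟨h1, h2⟩
    obtain ⟨b, hbD, hbc, hb1, hb2, hb3, hb4, hb5⟩ := h a haD hac
    have hb := hb3 this
    obtain ⟨w, hwD, hwc, hw1, hw2, hw3, hw4, hw5⟩ := h b hbD hbc
    have hw := hw4 hb
    exact ⟨a, b, w, hac, hbc, hwc, hwD, ha2, this.1, this.2, hb2, hb.1, hb.2, hw2, hw.1, hw.2⟩
  have start : ∃ z, z ∉ D ∧ z ≠ c ∧ A z c ∧ ¬ A z z := by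
    have hB : ∀ x, x ∉ D → x ≠ c → A x x → ¬ A x c → ∃ z, z ∉ D ∧ z ≠ c ∧ A z c ∧ ¬ A z z := by
      intro x hx hxc h1 h2
      obtain ⟨y, hyD, hy⟩ := h x hx hxc
      exact ⟨y, hyD, hy.1, hy.2.2.2.2.1 ⟨h1, h2⟩⟩
    obtain ⟨y, hyD, hy⟩ := h x0 hx0 hx0c
    by_cases h1 : A x0 c <;> by_cases h2 : A x0 x0
    · have := hy.2.2.2.1 ⟨h1, h2⟩
      exact hB y hyD hy.1 this.1 this.2
    · exact ⟨x0, hx0, hx0c, h1, h2⟩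
    · exact hB x0 hx0 hx0c h2 h1
    · have := hy.2.1; tauto
  have nostar : cst ∈ D := by
    by_contra hD
    have h2 : ¬ A cst cst := by
      rw [hA, hAi]
      have := d cst cst
      grind
    have h1 : A cst c := by
      obtain ⟨y, hyD, hy⟩ := h cst hD (Ne.symm hc)
      have := hy.2.1
      exact Or.resolve_right this h2
    obtain ⟨a, b, w, hac, hbc, hwc, hwD, q1, q2, q3, q4, q5, q6, q7, q8, q9⟩ :=
      chain cst hD (Ne.symm hc) h1 h2
    simp only [hA, hAi] at h1 h2 q1 q2 q3 q4 q5 q6 q7 q8 q9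
    have ga := gr_cases a
    have gb := gr_cases b
    have gw := gr_cases w
    have A1 : gr a = 2 := by have := d cst a; have := d a cst; have := d a a; grind
    have C1 : gr c = 0 := by
      have := d cst c; have := d c cst; have := d a c; have := d c a; grind
    have B1 : gr b = 1 := by
      have := d b b; have := d a b; have := d b a; have := d c a; have := d a c; grind
    have W1 : gr w = 0 := by
      have := d b w; have := d w b; have := d w w; grind
    have := d w c; have := d c w
    grind
  obtain ⟨z, hzD, hzc, h1, h2⟩ := start
  obtain ⟨a, b, w, hac, hbc, hwc, hwD, q1, q2, q3, q4, q5, q6, q7, q8, q9⟩ :=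
      chain z hzD hzc h1 h2
  have hzs : z ≠ cst := fun h => hzD (h ▸ nostar)
  have hws : w ≠ cst := fun h => hwD (h ▸ nostar)
  simp only [hA, hAi] at h1 h2 q1 q2 q3 q4 q5 q6 q7 q8 q9
  have ga := gr_cases a
  have gb := gr_cases b
  have gw := gr_cases w
  have gz := gr_cases z
  have Z1 : gr z = 0 := by grind
  have W1 : gr w = 0 := by grind
  have A1 : gr a = 1 ∨ gr a = 2 := by have := d a a; grind
  have B1 : gr b = 1 ∨ gr b = 2 := by have := d b b; grind
  have C1 : gr c = 1 ∨ gr c = 2 := by have := d z c; have := d c z; grind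
  rcases A1 with A1 | A1
  · have C2 : gr c = 2 := by have := d a c; have := d c a; grind
    have B2 : gr b = 2 := by have := d a b; have := d b a; grind
    have e1 : Down E s t w b := by have := d b w; grind
    have e2 : Down E s t w c := by have := d c w; grind
    exact hbc (f _ _ _ e1 e2)
  · have C2 : gr c = 1 := by have := d a c; have := d c a; grind
    have B2 : gr b = 1 := by have := d a b; have := d b a; grind
    have e1 : Down E s t a b := by have := d b a; grind
    have e2 : Down E s t a c := by have := d c a; grind
    exact hbc (f _ _ _ e1 e2)

instance : Finite (Vert n k s t) := by unfold Vert; infer_instance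

lemma reach_at (hE : MatchedLayered E) (hs : (s.2 : ℕ) = 0) (j : ℕ) (hj : j < k) :
    ∃ v : Fin n × Fin k, (v.2 : ℕ) = j ∧ Relation.ReflTransGen E s v := by
  induction j with
  | zero => exact ⟨s, hs, .refl⟩
  | succ j ih =>
    obtain ⟨v, hv, hr⟩ := ih (by omega)
    obtain ⟨w, hw, _⟩ := hE.2.1 v (by omega)
    exact ⟨w, by rw [hE.1 _ _ hw, hv], hr.tail hw⟩

lemma reach_unique (hE : MatchedLayered E) (hs : (s.2 : ℕ) = 0) {v w : Fin n × Fin k}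
    (hv : Relation.ReflTransGen E s v) (hw : Relation.ReflTransGen E s w)
    (h : (v.2 : ℕ) = w.2) : v = w := by
  induction hv generalizing w with
  | refl =>
    rcases Relation.ReflTransGen.cases_tail hw with h' | ⟨u, _, hu⟩
    · exact h'.symm
    · have := hE.1 _ _ hu; omega
  | tail hab e ih =>
    rename_i b c
    have h1 := hE.1 _ _ e
    rcases Relation.ReflTransGen.cases_tail hw with h' | ⟨u, hu', hu⟩
    · subst h'; omega
    · have h2 := hE.1 _ _ hu
      have := ih hu' (by omega)
      subst this
      exact (hE.2.1 b (by have := c.2.2; omega)).unique e hu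

end helpers

/-- `t` is reachable from `s` in the matched layered graph `G` if and
only if at most `k` vertices can be deleted from `G″` so that the remaining induced
graph satisfies property `P′`. -/
theorem stmt_13 {n k : ℕ} (E : Fin n × Fin k → Fin n × Fin k → Prop)
    (hE : MatchedLayered E) (s t : Fin n × Fin k)
    (hs : (s.2 : ℕ) = 0) (ht : (t.2 : ℕ) + 1 = k) :
    Relation.ReflTransGen E s t ↔
      ∃ D : Set (Vert n k s t), D.ncard ≤ k ∧
        PropP' (fun x y : ↥(Dᶜ) => Adj'' E s t x.1 y.1) := by
  have hst := @prop_iff (Vert n k s t) (Adj'' E s t)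
  constructor
  · intro hr
    refine ⟨Sum.inl '' {v | Relation.ReflTransGen E s v}, ?_, ?_⟩
    · refine (Set.ncard_image_le (Set.toFinite _)).trans ?_
      have := Set.ncard_le_ncard_of_injOn (s := {v | Relation.ReflTransGen E s v})
        (t := (Set.univ : Set (Fin k))) (fun v => v.2) (fun _ _ => Set.mem_univ _)
        (fun v hv w hw h => reach_unique hE hs hv hw (congrArg Fin.val h)) (Set.toFinite _)
      simpa using this
    · rw [hst]
      refine ⟨cst, (by rintro ⟨v, _, h⟩; cases h), fun x hx hxc => ?_⟩
      suffices H : ∃ y, y ∉ (Sum.inl '' {v | Relation.ReflTransGen E s v} : Set (Vert n k s t)) ∧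
          Down E s t x y by
        obtain ⟨y, hy, hd⟩ := H
        exact ⟨y, hy, (good_star hE hs ht hxc).2 hd⟩
      rcases x with w | a | a | a | a
      · have hw : ¬ Relation.ReflTransGen E s w := fun h => hx ⟨w, h, rfl⟩
        by_cases h0 : 0 < (w.2 : ℕ)
        · obtain ⟨v, hv, _⟩ := hE.2.2 w h0
          refine ⟨Sum.inl v, ?_, .base hv⟩
          rintro ⟨u, hu, h⟩
          cases h
          exact hw (Relation.ReflTransGen.tail hu hv)
        · have h2 : w.2 = s.2 := Fin.ext (by omega)
          have h1 : w.1 ≠ s.1 := fun h => hw (by rw [Prod.ext h h2])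
          have hd := Down.zero (E := E) (s := s) (t := t) ⟨w.1, h1⟩
          rw [← h2] at hd
          refine ⟨_, ?_, hd⟩
          rintro ⟨u, hu, h⟩
          cases h
      · refine ⟨_, ?_, .plus a⟩
        rintro ⟨u, hu, h⟩
        cases h
        exact a.2 (congrArg Prod.fst (reach_unique hE hs hu hr rfl))
      · refine ⟨_, ?_, .zeroMinus a⟩
        rintro ⟨u, hu, h⟩
        cases h
      · refine ⟨_, ?_, .minusBase a⟩
        rintro ⟨u, hu, h⟩
        cases h
        exact a.2 (congrArg Prod.fst (reach_unique hE hs hu .refl rfl))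
      · exact absurd rfl hxc
  · rintro ⟨D, hD, hP⟩
    rw [hst] at hP
    obtain ⟨c, hcD, hP⟩ := hP
    by_contra hr
    obtain ⟨e, he, hre⟩ := reach_at hE hs (t.2 : ℕ) t.2.2
    have he2 : e.2 = t.2 := Fin.ext he
    have he1 : e.1 ≠ t.1 := fun h => hr (by rwa [← Prod.ext h he2])
    by_cases hx0 : ∃ x0, x0 ∉ D ∧ x0 ≠ c
    · obtain ⟨x0, hx0D, hx0c⟩ := hx0
      have hc := only_star hE hs ht D c x0 hx0D hx0c hP
      subst hc
      have hdn : ∀ x, x ≠ cst → (∀ y, Down E s t x y → y ∈ D) → x ∈ D := by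
        intro x hxc hx
        by_contra hxD
        obtain ⟨y, hyD, hy⟩ := hP x hxD hxc
        exact hyD (hx y ((good_star hE hs ht hxc).1 hy))
      have hpath : ∀ v, Relation.ReflTransGen E s v → (Sum.inl v : Vert n k s t) ∈ D := by
        intro v hv
        induction hv with
        | refl =>
          refine hdn _ (by intro h; cases h) ?_
          intro y hy
          generalize hq : (Sum.inl s : Vert n k s t) = q at hy
          cases hy with
          | base h => cases hq; have := hE.1 _ _ h; omega
          | zero a => exact absurd (congrArg Prod.fst (Sum.inl.inj hq)).symm a.2
          | _ => cases hq
        | tail hab h ih =>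
          refine hdn _ (by intro h; cases h) ?_
          intro y hy
          rwa [down_fun hE hs hy (.base h)]
      have hplus : (Sum.inr (Sum.inl ⟨e.1, he1⟩) : Vert n k s t) ∈ D := by
        refine hdn _ (by intro h; cases h) ?_
        intro y hy
        rw [down_fun hE hs hy (.plus _)]
        have := hpath e hre
        rwa [show e = (e.1, t.2) from Prod.ext rfl he2] at this
      have hsub : (fun j : ℕ => some ((j : ℤ) + 1)) '' Set.Iio (k + 1) ⊆ layer '' D := by
        rintro _ ⟨j, hj, rfl⟩
        rcases Nat.lt_or_ge j k with h | h
        · obtain ⟨v, hv, hrv⟩ := reach_at hE hs j h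
          exact ⟨_, hpath v hrv, by simp [layer, hv]⟩
        · have : j = k := by have : j < k + 1 := hj; omega
          subst this
          exact ⟨_, hplus, rfl⟩
      have h1 := Set.ncard_le_ncard hsub (Set.toFinite _)
      have h2 := Set.ncard_image_le (f := layer) (Set.toFinite D)
      rw [Set.ncard_image_of_injective _ (by intro a b h; simpa using h)] at h1
      have h3 : (Set.Iio (k + 1)).ncard = k + 1 := by
        rw [← Finset.coe_Iio, Set.ncard_coe_finset]; simp
      omega
    · push Not at hx0
      -- everything but `c` is deleted: too many vertices
      have hsub : Set.univ ⊆ insert c D := by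
        intro x _
        by_cases hx : x ∈ D
        · exact Or.inr hx
        · exact Or.inl (hx0 x hx)
      have h1 := Set.ncard_le_ncard hsub (Set.toFinite _)
      have h2 := Set.ncard_insert_le c D
      have h3 : (Set.range (fun p : Fin k ⊕ Bool => (match p with
          | Sum.inl i => Sum.inl (e.1, i)
          | Sum.inr true => Sum.inr (Sum.inl ⟨e.1, he1⟩)
          | Sum.inr false => cst : Vert n k s t))).ncard = k + 2 := by
        rw [← Set.image_univ, Set.ncard_image_of_injective]
        · simp [Set.ncard_univ]
        · rintro (i | _ | _) (j | _ | _) h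
          all_goals first
            | rfl
            | (cases h; done)
            | (cases h; rfl)
      have h4 := Set.ncard_le_ncard (Set.subset_univ (Set.range (fun p : Fin k ⊕ Bool => (match p with
          | Sum.inl i => Sum.inl (e.1, i)
          | Sum.inr true => Sum.inr (Sum.inl ⟨e.1, he1⟩)
          | Sum.inr false => cst : Vert n k s t)))) (Set.toFinite _)
      omega
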